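/- Let k ≥ 1 and 1 ≤ s ≤ n. For every l with 1 ≤ l ≤ k−1, p^l_{n;≤s;k} = p^{l+1}_{n;≤s;k}; that is, p^1_{n;≤s;k} = p^2_{n;≤s;k} = … = p^k_{n;≤s;k}. -/

import Mathlib

/-- One parking step: a car with preference `a` parks in the first unoccupied
space `j` with `a ≤ j ≤ m`, if such a space exists; otherwise it leaves. -/
def parkStep (m : ℕ) (occ : Finset ℕ) (a : ℕ) : Finset ℕ :=
  if h : ((Finset.Icc a m) \ occ).Nonempty then
    insert (((Finset.Icc a m) \ occ).min' h) occ
  else occ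

/-- The set of occupied spaces after the cars with preference list `l`
(in order of arrival) have tried to park among spaces `1, …, m`. -/
def occupied (m : ℕ) (l : List ℕ) : Finset ℕ := l.foldl (parkStep m) ∅

/-- The number of cars that leave unparked. -/
def flaws (m : ℕ) (l : List ℕ) : ℕ := l.length - (occupied m l).card

/-- The preference list (with entries in `[1, s]`) encoded by a function `Fin n → Fin s`. -/
def prefList {n s : ℕ} (f : Fin n → Fin s) : List ℕ :=
  (List.ofFn f).map (fun i => (i : ℕ) + 1)

/-- `p n m s k` is the number of `k`-flaw preference sets of length `n` with `m`
parking spaces, all of whose entries are at most `s`. -/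
def p (n m s k : ℕ) : ℕ :=
  (Finset.univ.filter (fun f : Fin n → Fin s => flaws m (prefList f) = k)).card

/-- `pL n m s k l` is the number of `k`-flaw preference sets of length `n` with `m`
parking spaces, entries at most `s`, and first entry `l`. -/
def pL (n m s k l : ℕ) : ℕ :=
  (Finset.univ.filter (fun f : Fin n → Fin s =>
    flaws m (prefList f) = k ∧ (prefList f).head? = some l)).card

/-- The set of empty spaces. -/
def empties (m : ℕ) (l : List ℕ) : Finset ℕ := Finset.Icc 1 m \ occupied m l

/-- `n_α`: the number of entries equal to the first entry. -/
def nstat (l : List ℕ) : ℕ := l.count l.headI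

/-- `h_α`: the number of empty spaces smaller than the first entry. -/
def hstat (m : ℕ) (l : List ℕ) : ℕ := ((empties m l).filter (fun x => x < l.headI)).card

/-- `τ_α`: the number of entries smaller than the first entry, plus one. -/
def taustat (l : List ℕ) : ℕ := l.countP (fun a => a < l.headI) + 1

/-- `m_α`: the largest empty space. -/
def mstat (m : ℕ) (l : List ℕ) : ℕ := (empties m l).sup id


theorem parkStep_spec (m : ℕ) (O : Finset ℕ) (a : ℕ) :
    ((∀ x, a ≤ x → x ≤ m → x ∈ O) ∧ parkStep m O a = O) ∨
    (∃ x, x ∉ O ∧ a ≤ x ∧ x ≤ m ∧ (∀ y, a ≤ y → y < x → y ∈ O) ∧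
      parkStep m O a = insert x O) := by
  unfold parkStep
  split_ifs with h
  · right
    have hm := Finset.min'_mem _ h
    simp only [Finset.mem_sdiff, Finset.mem_Icc] at hm
    refine ⟨_, hm.2, hm.1.1, hm.1.2, ?_, rfl⟩
    intro y h1 h2
    by_contra h3
    have := Finset.min'_le (Finset.Icc a m \ O) y (by
      simp only [Finset.mem_sdiff, Finset.mem_Icc]
      exact ⟨⟨h1, by omega⟩, h3⟩)
    omega
  · left
    refine ⟨?_, rfl⟩
    intro x h1 h2
    by_contra h3
    exact h ⟨x, by simp [h1, h2, h3]⟩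

theorem parkStep_comm_aux (m : ℕ) (O : Finset ℕ) (a b : ℕ) (hab : a ≤ b) :
    parkStep m (parkStep m O a) b = parkStep m (parkStep m O b) a := by
  rcases parkStep_spec m O a with ⟨h1, e1⟩ | ⟨x, hx1, hx2, hx3, hx4, e1⟩ <;>
  rcases parkStep_spec m O b with ⟨h2, e2⟩ | ⟨y, hy1, hy2, hy3, hy4, e2⟩ <;>
  simp only [e1, e2]
  · exact absurd (h1 y (by omega) hy3) hy1
  · rcases parkStep_spec m (insert x O) b with ⟨h3, e3⟩ | ⟨z, hz1, hz2, hz3, hz4, e3⟩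
    · exact e3
    · exact absurd (h2 z hz2 hz3) (by simp at hz1; tauto)
  · rcases parkStep_spec m (insert x O) b with ⟨h3, e3⟩ | ⟨z, hz1, hz2, hz3, hz4, e3⟩ <;>
    rcases parkStep_spec m (insert y O) a with ⟨h4, e4⟩ | ⟨w, hw1, hw2, hw3, hw4, e4⟩ <;>
    rw [e3, e4] <;> simp only [Finset.mem_insert] at *
    · grind
    · by_cases hxy : x = y
      · subst hxy
        grind
      · grind
    · grind
    · by_cases hxy : x = y
      · subst hxy
        have : z = w := by
          rcases lt_trichotomy z w with h | h | h
          · grind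
          · exact h
          · grind
        rw [this]
      · have hw : w = x := by
          rcases lt_trichotomy w x with h | h | h
          · grind
          · exact h
          · grind
        have hz : z = y := by
          rcases lt_trichotomy z y with h | h | h
          · grind
          · exact h
          · grind
        rw [hw, hz, Finset.insert_comm]

theorem parkStep_comm (m : ℕ) (O : Finset ℕ) (a b : ℕ) :
    parkStep m (parkStep m O a) b = parkStep m (parkStep m O b) a := by
  rcases le_total a b with h | h
  · exact parkStep_comm_aux m O a b h
  · exact (parkStep_comm_aux m O b a h).symm

theorem foldl_parkStep (m a : ℕ) (L : List ℕ) : ∀ O : Finset ℕ,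
    L.foldl (parkStep m) (parkStep m O a) = parkStep m (L.foldl (parkStep m) O) a := by
  induction L with
  | nil => intro O; rfl
  | cons b L ih =>
    intro O
    simp only [List.foldl_cons]
    rw [parkStep_comm, ih]

theorem occupied_cons (m a : ℕ) (L : List ℕ) :
    occupied m (a :: L) = parkStep m (occupied m L) a := by
  unfold occupied
  rw [List.foldl_cons, foldl_parkStep]

theorem card_occupied_le (m : ℕ) (L : List ℕ) : (occupied m L).card ≤ L.length := by
  induction L with
  | nil => simp [occupied]
  | cons a L ih =>
    rw [occupied_cons, List.length_cons]
    rcases parkStep_spec m (occupied m L) a with ⟨h, e⟩ | ⟨x, hx, _, _, _, e⟩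
    · rw [e]; omega
    · rw [e, Finset.card_insert_of_notMem hx]; omega

theorem occupied_full (m s : ℕ) (L : List ℕ) (hL : ∀ a ∈ L, a ≤ s) :
    (occupied m L).card = L.length ∨ Finset.Icc s m ⊆ occupied m L := by
  induction L with
  | nil => simp [occupied]
  | cons a L ih =>
    have ih := ih (fun b hb => hL b (List.mem_cons_of_mem _ hb))
    have ha := hL a List.mem_cons_self
    rw [occupied_cons, List.length_cons]
    rcases parkStep_spec m (occupied m L) a with ⟨h, e⟩ | ⟨x, hx, _, _, _, e⟩
    · right
      rw [e]
      intro y hy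
      rw [Finset.mem_Icc] at hy
      exact h y (by omega) hy.2
    · rw [e, Finset.card_insert_of_notMem hx]
      rcases ih with h | h
      · left; omega
      · right; exact h.trans (Finset.subset_insert _ _)

theorem flaws_cons_iff (N k a : ℕ) (L : List ℕ) (hL : L.length = N) (hak : a ≤ k) (ha : 1 ≤ a) :
    flaws (N + 1) (a :: L) = k ↔ flaws (N + 1) L = k := by
  have hc := card_occupied_le (N + 1) L
  unfold flaws
  rw [occupied_cons, List.length_cons]
  rcases parkStep_spec (N + 1) (occupied (N + 1) L) a with ⟨h, e⟩ | ⟨x, hx, _, _, _, e⟩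
  · have : Finset.Icc a (N + 1) ⊆ occupied (N + 1) L := by
      intro y hy
      rw [Finset.mem_Icc] at hy
      exact h y hy.1 hy.2
    have := Finset.card_le_card this
    rw [Nat.card_Icc] at this
    rw [e]
    omega
  · rw [e, Finset.card_insert_of_notMem hx]
    omega

theorem prefList_eq {N s : ℕ} (f : Fin N → Fin s) :
    prefList f = List.ofFn (fun i => (f i : ℕ) + 1) := by
  have : ∀ L : List (Fin s), (L >>= fun a => pure (a : ℕ)) = L.map (Fin.val : Fin s → ℕ) := by
    intro L
    exact List.flatMap_pure_eq_map _ L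
  unfold prefList
  rw [this, List.map_map, List.map_ofFn]
  rfl

theorem prefList_succ {N s : ℕ} (f : Fin (N + 1) → Fin s) :
    prefList f = ((f 0 : ℕ) + 1) :: prefList (fun i => f i.succ) := by
  simp [prefList_eq, List.ofFn_succ]

theorem prefList_length {N s : ℕ} (f : Fin N → Fin s) : (prefList f).length = N := by
  simp [prefList_eq]

theorem pL_eq (N s k l : ℕ) (hl1 : 1 ≤ l) (hlk : l ≤ k) (hls : l ≤ s) :
    pL (N + 1) (N + 1) s k l = p N (N + 1) s k := by
  unfold pL p
  refine Finset.card_bij' (fun f _ => fun i => f i.succ)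
    (fun g _ => Fin.cons (⟨l - 1, by omega⟩ : Fin s) g) ?_ ?_ ?_ ?_
  · intro f hf
    simp only [Finset.mem_filter, Finset.mem_univ, true_and] at hf ⊢
    rw [prefList_succ] at hf
    simp only [List.head?_cons, Option.some.injEq] at hf
    rw [hf.2] at hf
    exact (flaws_cons_iff N k l _ (prefList_length _) hlk hl1).1 hf.1
  · intro g hg
    simp only [Finset.mem_filter, Finset.mem_univ, true_and] at hg ⊢
    rw [prefList_succ]
    simp only [Fin.cons_zero, Fin.cons_succ, List.head?_cons, Option.some.injEq]
    have : l - 1 + 1 = l := by omega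
    rw [this]
    exact ⟨(flaws_cons_iff N k l _ (prefList_length _) hlk hl1).2 hg, rfl⟩
  · intro f hf
    simp only [Finset.mem_filter, Finset.mem_univ, true_and] at hf
    rw [prefList_succ] at hf
    simp only [List.head?_cons, Option.some.injEq] at hf
    funext i
    refine Fin.cases ?_ (fun j => ?_) i
    · apply Fin.ext
      simp only [Fin.cons_zero]
      omega
    · simp
  · intro g hg
    funext i
    simp

theorem pL_zero (n s k l : ℕ) (hs1 : 1 ≤ s) (hsn : s ≤ n) (hsk : s ≤ k) :
    pL n n s k l = 0 := by
  unfold pL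
  rw [Finset.card_eq_zero, Finset.filter_eq_empty_iff]
  rintro f - ⟨h, -⟩
  have hlen := prefList_length f
  unfold flaws at h
  rcases occupied_full n s (prefList f) (by
    intro a ha
    simp only [prefList_eq, List.mem_ofFn] at ha
    obtain ⟨i, rfl⟩ := ha
    exact (f i).2) with h1 | h1
  · omega
  · have := Finset.card_le_card h1
    rw [Nat.card_Icc] at this
    omega

/-- Theorem 6.1: for `k ≥ 1`, `1 ≤ s ≤ n` and `1 ≤ l ≤ k-1`,
`p^l_{n;≤s;k} = p^{l+1}_{n;≤s;k}`. -/
theorem stmt8 (n s k l : ℕ) (hk : 1 ≤ k) (hs1 : 1 ≤ s) (hsn : s ≤ n)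
    (hl1 : 1 ≤ l) (hl2 : l ≤ k - 1) :
    pL n n s k l = pL n n s k (l + 1) := by
  by_cases hsk : s ≤ k
  · rw [pL_zero n s k l hs1 hsn hsk, pL_zero n s k (l + 1) hs1 hsn hsk]
  · obtain ⟨N, rfl⟩ : ∃ N, n = N + 1 := ⟨n - 1, by omega⟩
    rw [pL_eq N s k l hl1 (by omega) (by omega),
      pL_eq N s k (l + 1) (by omega) (by omega) (by omega)]
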